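/- arXiv:0909.2948 — 2 statements merged into one kernel-verified Lean document; each statement's English description precedes it below -/
import Mathlib

section
/- For k ≥ 2, let T be a feasible connected digraph of order k, and suppose n·rₙ² → 0 as n → ∞. Then n^{−k}·rₙ^{−2(k−1)}·E[H̃_{n,T}] → μ_T as n → ∞. -/
open MeasureTheory ProbabilityTheory Filter Real Set
open scoped Topology

noncomputable section

/-- The circular sector with apex `x`, radius `r`, central angle `a` and
inclination `y` (measured anticlockwise from the horizontal direction). -/
def sector (a : ℝ) (x : ℂ) (y r : ℝ) : Set ℂ :=
  {z : ℂ | ‖z - x‖ ≤ r ∧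
    ∃ t : ℝ, y ≤ t ∧ t ≤ y + a ∧
      z - x = (‖z - x‖ : ℂ) * Complex.exp (t * Complex.I)}

/-- Arc relation of the sector digraph on the configuration `x` (points) and `y`
(inclinations) with cutoff `r`: there is an arc from `i` to `j` iff `i ≠ j` and
the point `x j` lies in the sector of `i`. -/
def arc (a r : ℝ) {n : ℕ} (x : Fin n → ℂ) (y : Fin n → ℝ) (i j : Fin n) : Prop :=
  i ≠ j ∧ x j ∈ sector a (x i) (y i) r

/-- The sector digraph (cutoff `r`) on the `k`-point configuration `(x, y)` is
isomorphic to the digraph `T` on `Fin k`. -/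
def isoT (a r : ℝ) {k : ℕ} (T : Fin k → Fin k → Prop) (x : Fin k → ℂ) (y : Fin k → ℝ) : Prop :=
  ∃ e : Equiv.Perm (Fin k), ∀ i j, T i j ↔ arc a r x y (e i) (e j)

/-- The number of induced subdigraphs of the sector digraph on the configuration
`(x, y)` with cutoff `r` that are isomorphic to `T`. -/
def inducedCount (a r : ℝ) {k : ℕ} (T : Fin k → Fin k → Prop) {n : ℕ}
    (x : Fin n → ℂ) (y : Fin n → ℝ) : ℕ :=
  Set.ncard {s : Finset (Fin n) |
    ∃ g : Fin k ↪ Fin n, Finset.univ.map g = s ∧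
      ∀ i j, T i j ↔ arc a r x y (g i) (g j)}

/-- The number of isolated induced subdigraphs of the sector digraph on the
configuration `(x, y)` with cutoff `r` that are isomorphic to `T`: `k`-element
vertex subsets inducing a digraph isomorphic to `T` with no arc leaving the subset. -/
def isolatedCount (a r : ℝ) {k : ℕ} (T : Fin k → Fin k → Prop) {n : ℕ}
    (x : Fin n → ℂ) (y : Fin n → ℝ) : ℕ :=
  Set.ncard {s : Finset (Fin n) |
    (∃ g : Fin k ↪ Fin n, Finset.univ.map g = s ∧
      ∀ i j, T i j ↔ arc a r x y (g i) (g j)) ∧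
    ∀ i ∈ s, ∀ j, j ∉ s → ¬ arc a r x y i j}

open Classical in
/-- The indicator function `h_T`: equal to `1` if the sector digraph with radius `1`
on the configuration `(x, y)` is isomorphic to `T`, and `0` otherwise. -/
def hInd (a : ℝ) {k : ℕ} (T : Fin k → Fin k → Prop) (x : Fin k → ℂ) (y : Fin k → ℝ) : ℝ :=
  if isoT a 1 T x y then 1 else 0

/-- The `k`-point configuration `(0, z 1, …, z (k-1))`. -/
def pts {k : ℕ} (z : Fin (k - 1) → ℂ) (i : Fin k) : ℂ :=
  if h : (i : ℕ) = 0 then 0 else z ⟨(i : ℕ) - 1, by have := i.isLt; omega⟩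

/-- The Lebesgue measure of `S(x₁,…,x_k,y₁,…,y_k) = ∪_{i=1}^k S(xᵢ,yᵢ,1)`. -/
def sectorUnionVol (a : ℝ) {k : ℕ} (x : Fin k → ℂ) (y : Fin k → ℝ) : ℝ :=
  (volume (⋃ i, sector a (x i) (y i) 1)).toReal

/-- The function `φ_T`. -/
def phiT (a : ℝ) (k : ℕ) (T : Fin k → Fin k → Prop) (t : ℝ) : ℝ :=
  if k = 1 then Real.exp (-(t * a) / 2)
  else (t ^ (k - 1) / ((k - 1).factorial * (2 * π) ^ k)) *
    ∫ y in Set.univ.pi (fun _ : Fin k => Set.Ico 0 (2 * π)),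
      ∫ z : Fin (k - 1) → ℂ,
        hInd a T (pts z) y * Real.exp (-t * sectorUnionVol a (pts z) y)

/-- The constant `μ_T`. -/
def muT (a : ℝ) (k : ℕ) (T : Fin k → Fin k → Prop) (f : ℂ → ℝ) : ℝ :=
  (1 / (k.factorial * (2 * π) ^ k)) *
    ∫ y in Set.univ.pi (fun _ : Fin k => Set.Ico 0 (2 * π)),
      ∫ z : Fin (k - 1) → ℂ, ∫ x : ℂ, hInd a T (pts z) y * f x ^ k

lemma sector_meas (a r : ℝ) :
    MeasurableSet {p : (ℂ × ℝ) × ℂ | p.2 ∈ sector a p.1.1 p.1.2 r} := by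
  have h1 : IsClosed {q : ((ℂ × ℝ) × ℂ) × (Set.Icc (0:ℝ) a) |
      ‖q.1.2 - q.1.1.1‖ ≤ r ∧ q.1.2 - q.1.1.1 =
        (‖q.1.2 - q.1.1.1‖ : ℂ) * Complex.exp (((q.1.1.2 + (q.2 : ℝ) : ℝ) : ℂ) * Complex.I)} := by
    refine IsClosed.and (isClosed_le (by fun_prop) (by fun_prop)) (isClosed_eq (by fun_prop) ?_)
    fun_prop
  have h2 := isClosedMap_fst_of_compactSpace _ h1
  convert h2.measurableSet using 1
  ext ⟨⟨x, y⟩, z⟩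
  constructor
  · rintro ⟨hr, t, ht1, ht2, h⟩
    refine ⟨(((x, y), z), ⟨t - y, ⟨by linarith, by linarith⟩⟩), ⟨hr, ?_⟩, rfl⟩
    simpa using h
  · rintro ⟨⟨⟨⟨x', y'⟩, z'⟩, ⟨t, ⟨h1, h2⟩⟩⟩, ⟨h3, h4⟩, h5⟩
    simp only [Prod.mk.injEq] at h5
    obtain ⟨⟨rfl, rfl⟩, rfl⟩ := h5
    refine ⟨h3, y' + t, by linarith, by linarith, h4⟩

lemma isoT_meas (a r : ℝ) {k : ℕ} (T : Fin k → Fin k → Prop) :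
    MeasurableSet {p : (Fin k → ℂ) × (Fin k → ℝ) | isoT a r T p.1 p.2} := by
  have h1 : ∀ i j : Fin k, MeasurableSet
      {p : (Fin k → ℂ) × (Fin k → ℝ) | arc a r p.1 p.2 i j} := by
    intro i j
    unfold arc
    refine (MeasurableSet.const (i ≠ j)).inter ?_
    have hm : Measurable (fun p : (Fin k → ℂ) × (Fin k → ℝ) => (((p.1 i, p.2 i), p.1 j) : (ℂ × ℝ) × ℂ)) := by
      fun_prop
    exact hm (sector_meas a r)
  unfold isoT
  simp only [Set.ofPred_exists, Set.ofPred_forall]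
  refine MeasurableSet.iUnion fun e => MeasurableSet.iInter fun i => MeasurableSet.iInter fun j => ?_
  by_cases hT : T i j
  · simpa [hT] using h1 (e i) (e j)
  · simp only [hT, false_iff]
    exact (h1 (e i) (e j)).compl

lemma arc_scale (a r : ℝ) (hr : 0 < r) {k : ℕ} (x₀ : ℂ) (x : Fin k → ℂ) (y : Fin k → ℝ) (i j : Fin k) :
    arc a r (fun i => x₀ + r • x i) y i j ↔ arc a 1 x y i j := by
  unfold arc sector
  have e : (x₀ + r • x j) - (x₀ + r • x i) = r • (x j - x i) := by
    rw [smul_sub]; ring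
  have hn : ‖r • (x j - x i)‖ = r * ‖x j - x i‖ := by
    rw [norm_smul, Real.norm_of_nonneg hr.le]
  have hr' : (r : ℂ) ≠ 0 := by exact_mod_cast hr.ne'
  simp only [Set.mem_ofPred_eq, e, hn]
  refine and_congr_right fun _ => and_congr ?_ (exists_congr fun t => and_congr_right fun _ =>
    and_congr_right fun _ => ?_)
  · constructor
    · intro h; by_contra h'; push Not at h'; nlinarith
    · intro h; nlinarith
  · rw [Complex.real_smul, Complex.ofReal_mul, mul_assoc, mul_right_inj' hr']

lemma isoT_scale (a r : ℝ) (hr : 0 < r) {k : ℕ} (T : Fin k → Fin k → Prop) (x₀ : ℂ)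
    (x : Fin k → ℂ) (y : Fin k → ℝ) :
    isoT a r T (fun i => x₀ + r • x i) y ↔ isoT a 1 T x y := by
  unfold isoT
  simp only [arc_scale a r hr]

lemma isoT_bound (a : ℝ) {k : ℕ} (T : Fin k → Fin k → Prop)
    (hTconn : (SimpleGraph.fromRel T).Connected) (x : Fin k → ℂ) (y : Fin k → ℝ)
    (h : isoT a 1 T x y) (i j : Fin k) : ‖x i - x j‖ ≤ k := by
  obtain ⟨e, he⟩ := h
  have hadj : ∀ u v, (SimpleGraph.fromRel T).Adj u v → ‖x (e u) - x (e v)‖ ≤ 1 := by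
    intro u v huv
    rw [SimpleGraph.fromRel_adj] at huv
    rcases huv.2 with h | h
    · have := ((he _ _).1 h).2.1
      rwa [norm_sub_rev]
    · exact ((he _ _).1 h).2.1
  have hw : ∀ u v, ∀ p : (SimpleGraph.fromRel T).Walk u v, ‖x (e u) - x (e v)‖ ≤ p.length := by
    intro u v p
    induction p with
    | nil => simp
    | cons hh p ih =>
      have := norm_sub_le_norm_sub_add_norm_sub (x (e _)) (x (e _)) (x (e _)) |>.trans (add_le_add (hadj _ _ hh) ih)
      simp only [SimpleGraph.Walk.length_cons]; push_cast; linarith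
  obtain ⟨p, hp⟩ := (hTconn (e.symm i) (e.symm j)).exists_isPath
  have h1 := hw _ _ p
  simp only [Equiv.apply_symm_apply] at h1
  have h2 := hp.length_lt
  rw [Fintype.card_fin] at h2
  exact h1.trans (by exact_mod_cast h2.le)

lemma pi_withDens {n : ℕ} (g : ℂ → ℝ) (hg0 : ∀ x, 0 ≤ g x) (hgi : Integrable g) :
    haveI : IsFiniteMeasure (volume.withDensity fun x : ℂ => ENNReal.ofReal (g x)) :=
      isFiniteMeasure_withDensity_ofReal hgi.2
    Measure.pi (fun _ : Fin n => (volume.withDensity fun x : ℂ => ENNReal.ofReal (g x))) =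
      (volume : Measure (Fin n → ℂ)).withDensity (fun x => ENNReal.ofReal (∏ i, g (x i))) := by
  have : IsFiniteMeasure (volume.withDensity fun x : ℂ => ENNReal.ofReal (g x)) :=
      isFiniteMeasure_withDensity_ofReal hgi.2
  symm
  show _ = _
  refine (Measure.pi_eq ?_).symm
  intro s hs
  rw [withDensity_apply _ (MeasurableSet.univ_pi hs), ← lintegral_indicator (MeasurableSet.univ_pi hs)]
  have e : ∀ x : Fin n → ℂ, (Set.univ.pi s).indicator (fun x => ENNReal.ofReal (∏ i, g (x i))) x
      = ENNReal.ofReal (∏ i, (s i).indicator g (x i)) := by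
    intro x
    by_cases hx : x ∈ Set.univ.pi s
    · rw [Set.indicator_of_mem hx]
      congr 1
      refine Finset.prod_congr rfl fun i _ => ?_
      rw [Set.indicator_of_mem (hx i (Set.mem_univ i))]
    · rw [Set.indicator_of_notMem hx]
      simp only [Set.mem_pi, not_forall] at hx
      obtain ⟨i, _, hi⟩ := hx
      rw [Finset.prod_eq_zero (Finset.mem_univ i) (Set.indicator_of_notMem hi _), ENNReal.ofReal_zero]
  simp_rw [e]
  have hi : ∀ i, Integrable ((s i).indicator g) := fun i => hgi.indicator (hs i)
  have h0 : ∀ i x, 0 ≤ (s i).indicator g x := fun i x => Set.indicator_nonneg (fun x _ => hg0 x) x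
  rw [← ofReal_integral_eq_lintegral_ofReal, integral_fintype_prod_volume_eq_prod (fun i => (s i).indicator g),
    ENNReal.ofReal_prod_of_nonneg (fun i _ => integral_nonneg (h0 i))]
  · refine Finset.prod_congr rfl fun i _ => ?_
    rw [withDensity_apply _ (hs i), integral_indicator (hs i), ofReal_integral_eq_lintegral_ofReal hgi.restrict]
    exact Eventually.of_forall hg0
  · exact Integrable.fintype_prod (f := fun i => (s i).indicator g) hi
  · exact Eventually.of_forall fun x => Finset.prod_nonneg fun i _ => h0 i _
lemma pi_unif (n : ℕ) :
    Measure.pi (fun _ : Fin n => (ENNReal.ofReal (2 * π))⁻¹ • (volume : Measure ℝ).restrict (Set.Ico 0 (2 * π)))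
    = ((ENNReal.ofReal (2 * π))⁻¹) ^ n •
      (volume : Measure (Fin n → ℝ)).restrict (Set.univ.pi (fun _ : Fin n => Set.Ico 0 (2 * π))) := by
  have : IsFiniteMeasure ((ENNReal.ofReal (2 * π))⁻¹ • (volume : Measure ℝ).restrict (Set.Ico 0 (2 * π))) :=
    Measure.smul_finite _ (by simp [Real.pi_pos])
  refine Measure.pi_eq ?_
  intro s hs
  rw [volume_pi, Measure.restrict_pi_pi, Measure.smul_apply, Measure.pi_pi]
  simp only [Measure.smul_apply, smul_eq_mul, Finset.prod_mul_distrib, Finset.prod_const, Finset.card_univ,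
    Fintype.card_fin]

lemma pts_zero {m : ℕ} (z : Fin m → ℂ) : pts (k := m + 1) z 0 = 0 := by simp [pts]
lemma pts_succ {m : ℕ} (z : Fin m → ℂ) (i : Fin m) : pts (k := m + 1) z i.succ = z i := by
  simp [pts]

lemma pts_meas {m : ℕ} : Measurable (fun z : Fin m → ℂ => pts (k := m + 1) z) := by
  refine measurable_pi_lambda _ fun i => ?_
  refine Fin.cases ?_ (fun i => ?_) i
  · simp only [pts_zero]; fun_prop
  · simp only [pts_succ]; fun_prop

lemma hInd_le {a : ℝ} {k : ℕ} (T : Fin k → Fin k → Prop) (x : Fin k → ℂ) (y : Fin k → ℝ) :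
    hInd a T x y ≤ 1 := by unfold hInd; split_ifs <;> norm_num
lemma hInd_nonneg {a : ℝ} {k : ℕ} (T : Fin k → Fin k → Prop) (x : Fin k → ℂ) (y : Fin k → ℝ) :
    0 ≤ hInd a T x y := by unfold hInd; split_ifs <;> norm_num

lemma hInd_meas (a : ℝ) {m : ℕ} (T : Fin (m+1) → Fin (m+1) → Prop) :
    Measurable (fun p : (Fin (m+1) → ℝ) × (ℂ × (Fin m → ℂ)) => hInd a T (pts (k := m+1) p.2.2) p.1) := by
  unfold hInd
  refine Measurable.ite ?_ measurable_const measurable_const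
  have : Measurable (fun p : (Fin (m+1) → ℝ) × (ℂ × (Fin m → ℂ)) => (pts (k := m+1) p.2.2, p.1)) :=
    (pts_meas.comp (by fun_prop)).prodMk measurable_fst
  exact this (isoT_meas a 1 T)

def Gfun (a : ℝ) {m : ℕ} (T : Fin (m+1) → Fin (m+1) → Prop) (g : ℂ → ℝ) (r : ℝ)
    (p : (Fin (m+1) → ℝ) × (ℂ × (Fin m → ℂ))) : ℝ :=
  hInd a T (pts (k := m+1) p.2.2) p.1 * (g p.2.1 * ∏ i, g (p.2.1 + r • p.2.2 i))

lemma Gfun_meas (a : ℝ) {m : ℕ} (T : Fin (m+1) → Fin (m+1) → Prop) (g : ℂ → ℝ) (hg : Measurable g) (r : ℝ) :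
    Measurable (Gfun a T g r) := by
  unfold Gfun
  refine (hInd_meas a T).mul ?_
  refine (hg.comp (by fun_prop)).mul (Finset.measurable_prod _ fun i _ => ?_)
  exact hg.comp (by fun_prop)

def Bfun (m : ℕ) (g : ℂ → ℝ) (C : ℝ) (q : ℂ × (Fin m → ℂ)) : ℝ :=
  g q.1 * (Metric.closedBall (0 : Fin m → ℂ) (m+1)).indicator (fun _ => C ^ m) q.2

lemma Gfun_bound (a : ℝ) {m : ℕ} (T : Fin (m+1) → Fin (m+1) → Prop)
    (hTconn : (SimpleGraph.fromRel T).Connected)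
    (g : ℂ → ℝ) (hg0 : ∀ x, 0 ≤ g x) (C : ℝ) (hC : ∀ x, g x ≤ C) (r : ℝ)
    (p : (Fin (m+1) → ℝ) × (ℂ × (Fin m → ℂ))) : ‖Gfun a T g r p‖ ≤ Bfun m g C p.2 := by
  unfold Gfun Bfun
  have hp : 0 ≤ ∏ i, g (p.2.1 + r • p.2.2 i) := Finset.prod_nonneg fun i _ => hg0 _
  rw [Real.norm_of_nonneg (mul_nonneg (hInd_nonneg _ _ _) (mul_nonneg (hg0 _) hp))]
  have hpC : ∏ i, g (p.2.1 + r • p.2.2 i) ≤ C ^ m := by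
    refine (Finset.prod_le_prod (fun i _ => hg0 _) (fun i _ => hC _)).trans ?_
    simp
  by_cases h : isoT a 1 T (pts (k := m+1) p.2.2) p.1
  · have hb : p.2.2 ∈ Metric.closedBall (0 : Fin m → ℂ) (m+1) := by
      rw [mem_closedBall_zero_iff, pi_norm_le_iff_of_nonneg (by positivity)]
      intro i
      have := isoT_bound a T hTconn _ _ h i.succ 0
      rw [pts_zero, pts_succ, sub_zero] at this
      exact_mod_cast this
    rw [Set.indicator_of_mem hb, hInd, if_pos h, one_mul]
    exact mul_le_mul_of_nonneg_left hpC (hg0 _)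
  · rw [hInd, if_neg h, zero_mul]
    exact mul_nonneg (hg0 _) (Set.indicator_nonneg (fun _ _ => hp.trans hpC) _)

lemma Bfun_int (m : ℕ) (g : ℂ → ℝ) (hgi : Integrable g) (C : ℝ) :
    Integrable (Bfun m g C) ((volume : Measure ℂ).prod (volume : Measure (Fin m → ℂ))) := by
  unfold Bfun
  refine Integrable.mul_prod (f := g) (g := (Metric.closedBall (0 : Fin m → ℂ) (m+1)).indicator (fun _ => C ^ m)) hgi ?_
  exact (integrable_indicator_iff Metric.isClosed_closedBall.measurableSet).2
    (integrableOn_const (isCompact_closedBall _ _).measure_lt_top.ne)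

lemma Bfun_int' (m : ℕ) (g : ℂ → ℝ) (hgi : Integrable g) (C : ℝ) (P : Measure (Fin (m+1) → ℝ)) [IsFiniteMeasure P] :
    Integrable (fun p : (Fin (m+1) → ℝ) × (ℂ × (Fin m → ℂ)) => Bfun m g C p.2)
      (P.prod ((volume : Measure ℂ).prod (volume : Measure (Fin m → ℂ)))) :=
  (Bfun_int m g hgi C).comp_snd P

lemma G_tendsto (a : ℝ) {m : ℕ} (T : Fin (m+1) → Fin (m+1) → Prop)
    (hTconn : (SimpleGraph.fromRel T).Connected) (f : ℂ → ℝ) (hfc : ∀ᵐ x : ℂ, ContinuousAt f x)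
    (g : ℂ → ℝ) (hg : Measurable g) (hgf : ∀ᵐ x, g x = f x)
    (hg0 : ∀ x, 0 ≤ g x) (hgi : Integrable g) (C : ℝ) (hC : ∀ x, g x ≤ C)
    (P : Measure (Fin (m+1) → ℝ)) [IsFiniteMeasure P]
    (r : ℕ → ℝ) (hr : Tendsto r atTop (𝓝 0)) :
    Tendsto (fun n => ∫ p, Gfun a T g (r n) p ∂(P.prod ((volume : Measure ℂ).prod (volume : Measure (Fin m → ℂ)))))
      atTop (𝓝 (∫ y, (∫ z : Fin m → ℂ, ∫ x : ℂ, hInd a T (pts (k := m+1) z) y * f x ^ (m+1)) ∂P)) := by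
  have key : ∫ y, (∫ z : Fin m → ℂ, ∫ x : ℂ, hInd a T (pts (k := m+1) z) y * f x ^ (m+1)) ∂P
      = ∫ p, Gfun a T g 0 p ∂(P.prod ((volume : Measure ℂ).prod (volume : Measure (Fin m → ℂ)))) := by
    rw [integral_prod]
    · refine integral_congr_ae (Eventually.of_forall fun y => ?_)
      simp only
      rw [integral_prod_symm]
      · refine integral_congr_ae (Eventually.of_forall fun z => ?_)
        simp only
        refine integral_congr_ae ?_
        filter_upwards [hgf] with x hx
        simp [Gfun, hx, pow_succ']
      · exact (Bfun_int m g hgi C).mono' ((Gfun_meas a T g hg 0).comp measurable_prodMk_left).aestronglyMeasurable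
          (Eventually.of_forall fun q => Gfun_bound a T hTconn g hg0 C hC 0 (y, q))
    · exact (Bfun_int' m g hgi C P).mono' (Gfun_meas a T g hg 0).aestronglyMeasurable
          (Eventually.of_forall fun q => Gfun_bound a T hTconn g hg0 C hC 0 q)
  rw [key]
  refine tendsto_integral_of_dominated_convergence (fun p => Bfun m g C p.2)
    (fun n => (Gfun_meas a T g hg _).aestronglyMeasurable) (Bfun_int' m g hgi C P)
    (fun n => Eventually.of_forall fun q => Gfun_bound a T hTconn g hg0 C hC _ q) ?_
  have h1 : ∀ᵐ q : ℂ × (Fin m → ℂ) ∂((volume : Measure ℂ).prod (volume : Measure (Fin m → ℂ))),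
      ContinuousAt f q.1 ∧ g q.1 = f q.1 ∧ ∀ n i, g (q.1 + r n • q.2 i) = f (q.1 + r n • q.2 i) := by
    have hA := Measure.quasiMeasurePreserving_fst (μ := (volume : Measure ℂ)) (ν := (volume : Measure (Fin m → ℂ)))
    have hB : ∀ n i, Measure.QuasiMeasurePreserving (fun q : ℂ × (Fin m → ℂ) => q.1 + r n • q.2 i)
        ((volume : Measure ℂ).prod (volume : Measure (Fin m → ℂ))) volume := by
      intro n i
      refine QuasiMeasurePreserving.prod_of_left (by fun_prop) (Eventually.of_forall fun z => ?_)
      exact (measurePreserving_add_right volume (r n • z i)).quasiMeasurePreserving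
    filter_upwards [hA.ae hfc, hA.ae hgf, ae_all_iff.2 fun n => ae_all_iff.2 fun i => (hB n i).ae hgf] with q h1 h2 h3
    exact ⟨h1, h2, h3⟩
  have h2 := (Measure.quasiMeasurePreserving_snd (μ := P) (ν := (volume : Measure ℂ).prod (volume : Measure (Fin m → ℂ)))).ae h1
  filter_upwards [h2] with p hp
  obtain ⟨hc, he, hall⟩ := hp
  unfold Gfun
  refine Tendsto.const_mul _ (Tendsto.const_mul _ (tendsto_finsetProd _ fun i _ => ?_))
  simp only [hall, zero_smul, add_zero, he]
  refine hc.tendsto.comp ?_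
  have : Tendsto (fun n => p.2.1 + r n • p.2.2 i) atTop (𝓝 (p.2.1 + (0:ℝ) • p.2.2 i)) :=
    tendsto_const_nhds.add (hr.smul_const _)
  simpa using this

lemma q_eq (a : ℝ) {m : ℕ} (T : Fin (m+1) → Fin (m+1) → Prop)
    (hTconn : (SimpleGraph.fromRel T).Connected)
    (g : ℂ → ℝ) (hg : Measurable g) 
    (hg0 : ∀ x, 0 ≤ g x) (hgi : Integrable g) (C : ℝ) (hC : ∀ x, g x ≤ C)
    (P : Measure (Fin (m+1) → ℝ)) [IsFiniteMeasure P]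
    (r : ℝ) (hr : 0 < r) :
    (((volume : Measure (Fin (m+1) → ℂ)).withDensity (fun x => ENNReal.ofReal (∏ i, g (x i)))).prod P).real
      {p | isoT a r T p.1 p.2} = r ^ (2 * m) *
      ∫ p, Gfun a T g r p ∂(P.prod ((volume : Measure ℂ).prod (volume : Measure (Fin m → ℂ)))) := by
  have hpi : Integrable (fun x : Fin (m+1) → ℂ => ∏ i, g (x i)) :=
    Integrable.fintype_prod (f := fun _ => g) (fun _ => hgi)
  have hpm : Measurable (fun x : Fin (m+1) → ℂ => ∏ i, g (x i)) :=
    Finset.measurable_prod _ fun i _ => hg.comp (measurable_pi_apply i)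
  have hp0 : ∀ x : Fin (m+1) → ℂ, 0 ≤ ∏ i, g (x i) := fun x => Finset.prod_nonneg fun i _ => hg0 _
  have : IsFiniteMeasure ((volume : Measure (Fin (m+1) → ℂ)).withDensity (fun x => ENNReal.ofReal (∏ i, g (x i)))) :=
    isFiniteMeasure_withDensity_ofReal hpi.2
  rw [← integral_indicator_one (isoT_meas a r T), integral_prod_symm, integral_prod, ← integral_const_mul]
  rotate_left
  · exact (Bfun_int' m g hgi C P).mono' (Gfun_meas a T g hg _).aestronglyMeasurable
          (Eventually.of_forall fun q => Gfun_bound a T hTconn g hg0 C hC _ q)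
  · exact (integrable_const (1:ℝ)).indicator (isoT_meas a r T)
  refine integral_congr_ae (Eventually.of_forall fun y => ?_)
  simp only
  have hm1 : Measurable (fun x : Fin (m+1) → ℂ => ({p | isoT a r T p.1 p.2} : Set ((Fin (m+1) → ℂ) × (Fin (m+1) → ℝ))).indicator (1 : (Fin (m+1) → ℂ) × (Fin (m+1) → ℝ) → ℝ) (x, y)) :=
    (measurable_one.indicator (isoT_meas a r T)).comp measurable_prodMk_right
  set F : (Fin (m+1) → ℂ) → ℝ := fun x => (∏ i, g (x i)) * 
    ({p | isoT a r T p.1 p.2} : Set ((Fin (m+1) → ℂ) × (Fin (m+1) → ℝ))).indicator (1 : (Fin (m+1) → ℂ) × (Fin (m+1) → ℝ) → ℝ) (x, y) with hF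
  have hFi : Integrable F := by
    refine hpi.mono' (hpm.mul hm1).aestronglyMeasurable (Eventually.of_forall fun x => ?_)
    rw [hF]; simp only
    by_cases hx : (x, y) ∈ ({p | isoT a r T p.1 p.2} : Set ((Fin (m+1) → ℂ) × (Fin (m+1) → ℝ)))
    · rw [Set.indicator_of_mem hx, Pi.one_apply, mul_one, Real.norm_of_nonneg (hp0 x)]
    · rw [Set.indicator_of_notMem hx, mul_zero, norm_zero]; exact hp0 x
  rw [integral_withDensity_eq_integral_toReal_smul (by fun_prop) (by simp)]
  have e1 : ∀ x, (ENNReal.ofReal (∏ i, g (x i))).toReal • 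
    ({p | isoT a r T p.1 p.2} : Set ((Fin (m+1) → ℂ) × (Fin (m+1) → ℝ))).indicator (1 : (Fin (m+1) → ℂ) × (Fin (m+1) → ℝ) → ℝ) (x, y) = F x := by
    intro x; rw [ENNReal.toReal_ofReal (hp0 x), smul_eq_mul]
  simp only [e1]
  have mp := (volume_preserving_piFinSuccAbove (fun _ : Fin (m+1) => ℂ) 0).symm
  rw [← mp.integral_comp']
  have hFi2 := (mp.integrable_comp_emb (MeasurableEquiv.measurableEmbedding _)).2 hFi
  rw [Function.comp_def] at hFi2
  rw [Measure.volume_eq_prod, integral_prod _ hFi2, integral_prod, ← integral_const_mul]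
  rotate_left
  · exact (Bfun_int m g hgi C).mono' ((Gfun_meas a T g hg _).comp measurable_prodMk_left).aestronglyMeasurable
          (Eventually.of_forall fun q => Gfun_bound a T hTconn g hg0 C hC _ (y, q))
  refine integral_congr_ae (Eventually.of_forall fun x₀ => ?_)
  simp only
  have hs := Measure.integral_comp_smul (volume : Measure (Fin m → ℂ))
    (fun z => F ((MeasurableEquiv.piFinSuccAbove (fun _ : Fin (m+1) => ℂ) 0).symm (x₀, (fun _ => x₀) + z))) r
  rw [integral_add_left_eq_self (μ := (volume : Measure (Fin m → ℂ))) (fun z => F ((MeasurableEquiv.piFinSuccAbove (fun _ : Fin (m+1) => ℂ) 0).symm (x₀, z)))] at hs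
  have hfr : Module.finrank ℝ (Fin m → ℂ) = 2 * m := by
    rw [Module.finrank_pi_fintype]; simp [Complex.finrank_real_complex, mul_comm]
  rw [hfr, abs_of_pos (by positivity), smul_eq_mul] at hs
  have hrp : r ^ (2 * m) ≠ 0 := by positivity
  rw [eq_comm, inv_mul_eq_iff_eq_mul₀ hrp] at hs
  rw [hs]
  congr 1
  refine integral_congr_ae (Eventually.of_forall fun z => ?_)
  simp only [hF, Gfun]
  have e2 : (MeasurableEquiv.piFinSuccAbove (fun _ : Fin (m+1) => ℂ) 0).symm (x₀, (fun _ => x₀) + r • z)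
      = fun i => x₀ + r • pts (k := m+1) z i := by
    ext i
    refine Fin.cases ?_ (fun i => ?_) i
    · simp [pts_zero, MeasurableEquiv.piFinSuccAbove]
    · simp [pts_succ, MeasurableEquiv.piFinSuccAbove]
  rw [e2, Fin.prod_univ_succ]
  simp only [pts_zero, pts_succ, smul_zero, add_zero]
  rw [mul_comm]
  congr 1
  by_cases h : isoT a 1 T (pts (k := m+1) z) y
  · rw [hInd, if_pos h, Set.indicator_of_mem]
    · rfl
    · exact (isoT_scale a r hr T x₀ _ y).2 h
  · rw [hInd, if_neg h, Set.indicator_of_notMem]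
    exact fun h' => h ((isoT_scale a r hr T x₀ _ y).1 h')
lemma q_lim (f : ℂ → ℝ) (hf0 : ∀ x, 0 ≤ f x) (C : ℝ) (hC : ∀ x, f x ≤ C)
    (hfc : ∀ᵐ x : ℂ, ContinuousAt f x) (a : ℝ)
    (hprob : ∫⁻ x, ENNReal.ofReal (f x) = 1)
    {m : ℕ} (T : Fin (m+1) → Fin (m+1) → Prop) (hTconn : (SimpleGraph.fromRel T).Connected)
    (r : ℕ → ℝ) (hrpos : ∀ n, 0 < r n) (hr : Tendsto r atTop (𝓝 0)) :
    Tendsto (fun n => (Measure.pi (fun _ : Fin (m+1) => (volume.withDensity fun x => ENNReal.ofReal (f x)).prod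
        ((ENNReal.ofReal (2 * π))⁻¹ • (volume : Measure ℝ).restrict (Set.Ico 0 (2 * π))))).real
        {w | isoT a (r n) T (fun i => (w i).1) (fun i => (w i).2)} / r n ^ (2 * m)) atTop
      (𝓝 ((m+1).factorial * muT a (m+1) T f)) := by
  classical
  set S : Set ℂ := {x | ContinuousAt f x} with hS
  have hSm : MeasurableSet S := measurableSet_of_continuousAt f
  set g : ℂ → ℝ := S.indicator f with hgdef
  have hg : Measurable g := by
    rw [hgdef, ← Set.piecewise_eq_indicator]
    refine ContinuousOn.measurable_piecewise ?_ continuousOn_const hSm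
    exact fun x hx => (show ContinuousAt f x from hx).continuousWithinAt
  have hgf : ∀ᵐ x, g x = f x := by
    filter_upwards [hfc] with x hx
    exact Set.indicator_of_mem (show x ∈ S from hx) f
  have hg0 : ∀ x, 0 ≤ g x := fun x => Set.indicator_nonneg (fun x _ => hf0 x) x
  have hgC : ∀ x, g x ≤ C := by
    intro x
    by_cases hx : x ∈ S
    · rw [hgdef, Set.indicator_of_mem hx]; exact hC x
    · rw [hgdef, Set.indicator_of_notMem hx]; exact (hf0 x).trans (hC x)
  have hlin : ∫⁻ x, ENNReal.ofReal (g x) = 1 := by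
    rw [← hprob]; refine lintegral_congr_ae ?_
    filter_upwards [hgf] with x hx; rw [hx]
  have hgi : Integrable g := by
    refine ⟨hg.aestronglyMeasurable, ?_⟩
    rw [hasFiniteIntegral_iff_ofReal (Eventually.of_forall hg0), hlin]
    exact ENNReal.one_lt_top
  have hmeq : (volume.withDensity fun x => ENNReal.ofReal (f x)) =
      volume.withDensity fun x => ENNReal.ofReal (g x) := by
    refine withDensity_congr_ae ?_
    filter_upwards [hgf] with x hx; rw [hx]
  have i1 : IsFiniteMeasure (volume.withDensity fun x : ℂ => ENNReal.ofReal (g x)) :=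
      isFiniteMeasure_withDensity_ofReal hgi.2
  have i2 : IsFiniteMeasure ((ENNReal.ofReal (2 * π))⁻¹ • (volume : Measure ℝ).restrict (Set.Ico 0 (2 * π))) :=
    Measure.smul_finite _ (by simp [Real.pi_pos])
  set ρ : Measure ℝ := (ENNReal.ofReal (2 * π))⁻¹ • (volume : Measure ℝ).restrict (Set.Ico 0 (2 * π)) with hρ
  have hq : ∀ n, (Measure.pi (fun _ : Fin (m+1) => (volume.withDensity fun x => ENNReal.ofReal (f x)).prod ρ)).real
        {w | isoT a (r n) T (fun i => (w i).1) (fun i => (w i).2)} / r n ^ (2 * m)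
      = ∫ p, Gfun a T g (r n) p ∂((Measure.pi fun _ : Fin (m+1) => ρ).prod ((volume : Measure ℂ).prod (volume : Measure (Fin m → ℂ)))) := by
    intro n
    have h1 := q_eq a T hTconn g hg hg0 hgi C hgC (Measure.pi fun _ : Fin (m+1) => ρ) (r n) (hrpos n)
    rw [div_eq_iff (pow_pos (hrpos n) _).ne', mul_comm, ← h1, hmeq, ← pi_withDens g hg0 hgi]
    have mp := measurePreserving_arrowProdEquivProdArrow ℂ ℝ (Fin (m+1))
      (fun _ => volume.withDensity fun x => ENNReal.ofReal (g x)) (fun _ => ρ)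
    rw [measureReal_def, measureReal_def, ← mp.measure_preimage (isoT_meas a (r n) T).nullMeasurableSet]
    rfl
  simp only [hq]
  have hlim := G_tendsto a T hTconn f hfc g hg hgf hg0 hgi C hgC (Measure.pi fun _ : Fin (m+1) => ρ) r hr
  convert hlim using 2
  rw [hρ, pi_unif, integral_smul_measure, muT]
  have hfac : ((m+1).factorial : ℝ) ≠ 0 := by exact_mod_cast (Nat.factorial_pos _).ne'
  have h2 : (((ENNReal.ofReal (2 * π))⁻¹) ^ (m+1)).toReal = ((2 * π) ^ (m+1))⁻¹ := by
    rw [ENNReal.toReal_pow, ENNReal.toReal_inv, ENNReal.toReal_ofReal (by positivity), inv_pow]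
  rw [h2, smul_eq_mul, ← mul_assoc]
  congr 1
  field_simp

lemma iso_iff (a r : ℝ) {k n : ℕ} (T : Fin k → Fin k → Prop) (x : Fin n → ℂ) (y : Fin n → ℝ)
    (s : Finset (Fin n)) (hs : s.card = k) :
    (∃ g : Fin k ↪ Fin n, Finset.univ.map g = s ∧ ∀ i j, T i j ↔ arc a r x y (g i) (g j)) ↔
      isoT a r T (fun i => x (s.orderEmbOfFin hs i)) (fun i => y (s.orderEmbOfFin hs i)) := by
  have harc : ∀ i j, arc a r (fun i => x (s.orderEmbOfFin hs i)) (fun i => y (s.orderEmbOfFin hs i)) i j ↔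
      arc a r x y (s.orderEmbOfFin hs i) (s.orderEmbOfFin hs j) := by
    intro i j
    unfold arc
    simp
  unfold isoT
  simp only [harc]
  constructor
  · rintro ⟨g, hg, hT⟩
    have h1 : ∀ i, ∃ j, s.orderEmbOfFin hs j = g i := by
      intro i
      have : g i ∈ s := by rw [← hg]; simp
      have h2 := Finset.range_orderEmbOfFin s hs
      have : g i ∈ Set.range (s.orderEmbOfFin hs) := by rw [h2]; exact this
      exact this
    choose e he using h1
    have hinj : Function.Injective e := by
      intro i j hij
      apply g.injective
      rw [← he, ← he, hij]
    refine ⟨Equiv.ofBijective e (Finite.injective_iff_bijective.1 hinj), fun i j => ?_⟩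
    rw [hT]; simp [he]
  · rintro ⟨e, he⟩
    refine ⟨e.toEmbedding.trans (s.orderEmbOfFin hs).toEmbedding, ?_, fun i j => by simpa using he i j⟩
    rw [← Finset.map_map]
    simp

lemma pair_bound (a r : ℝ) {k : ℕ} (T : Fin k → Fin k → Prop) (ν : Measure (ℂ × ℝ)) [IsProbabilityMeasure ν]
    (D : ENNReal) (hD : ∀ c, ν {v | ‖v.1 - c‖ ≤ r} ≤ D) (i : Fin k) :
    Measure.pi (fun _ : Fin (k+1) => ν) {w | isoT a r T (fun i => (w i.succ).1) (fun i => (w i.succ).2) ∧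
      ‖(w 0).1 - (w i.succ).1‖ ≤ r} ≤
    D * Measure.pi (fun _ : Fin k => ν) {w | isoT a r T (fun i => (w i).1) (fun i => (w i).2)} := by
  have hI : MeasurableSet {w : Fin k → ℂ × ℝ | isoT a r T (fun i => (w i).1) (fun i => (w i).2)} := by
    have : Measurable (fun w : Fin k → ℂ × ℝ => ((fun i => (w i).1, fun i => (w i).2) : (Fin k → ℂ) × (Fin k → ℝ))) := by
      fun_prop
    exact this (isoT_meas a r T)
  set S : Set ((ℂ × ℝ) × (Fin k → ℂ × ℝ)) := {p | isoT a r T (fun i => (p.2 i).1) (fun i => (p.2 i).2) ∧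
      ‖p.1.1 - (p.2 i).1‖ ≤ r} with hS
  have hS2 : MeasurableSet {p : (ℂ × ℝ) × (Fin k → ℂ × ℝ) | ‖p.1.1 - (p.2 i).1‖ ≤ r} :=
    measurableSet_le (by fun_prop) (by fun_prop)
  have hSm : MeasurableSet S := (measurable_snd hI).inter hS2
  have mp := measurePreserving_piFinSuccAbove (fun _ : Fin (k+1) => ν) 0
  have e : {w : Fin (k+1) → ℂ × ℝ | isoT a r T (fun i => (w i.succ).1) (fun i => (w i.succ).2) ∧
      ‖(w 0).1 - (w i.succ).1‖ ≤ r} = (MeasurableEquiv.piFinSuccAbove (fun _ : Fin (k+1) => ℂ × ℝ) 0) ⁻¹' S := by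
    ext w
    rfl
  rw [e, mp.measure_preimage hSm.nullMeasurableSet, Measure.prod_apply_symm hSm, ← lintegral_indicator_const hI]
  refine lintegral_mono fun w => ?_
  by_cases hw : w ∈ {w : Fin k → ℂ × ℝ | isoT a r T (fun i => (w i).1) (fun i => (w i).2)}
  · rw [Set.indicator_of_mem hw]
    refine (measure_mono ?_).trans (hD (w i).1)
    exact fun v hv => hv.2
  · rw [Set.indicator_of_notMem hw, nonpos_iff_eq_zero]
    convert measure_empty (μ := ν)
    ext v
    simp only [Set.mem_preimage, Set.mem_empty_iff_false, iff_false]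
    exact fun h => hw h.1

lemma law_tuple {Ω : Type} [MeasureSpace Ω] [IsProbabilityMeasure (ℙ : Measure Ω)]
    (Z : ℕ → Ω → ℂ × ℝ) (hZm : ∀ i, Measurable (Z i)) (hZi : iIndepFun Z ℙ)
    (ν : Measure (ℂ × ℝ)) (hZd : ∀ i, Measure.map (Z i) ℙ = ν) {k : ℕ} (g : Fin k → ℕ) (hg : Function.Injective g) :
    Measure.map (fun ω i => Z (g i) ω) ℙ = Measure.pi (fun _ : Fin k => ν) := by
  have h := hZi.precomp hg
  rw [iIndepFun_iff_map_fun_eq_pi_map (fun i => (hZm _).aemeasurable)] at h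
  simp only [hZd] at h
  exact h
lemma count_bound {Ω : Type} [MeasureSpace Ω] [IsProbabilityMeasure (ℙ : Measure Ω)]
    (Z : ℕ → Ω → ℂ × ℝ) (hZm : ∀ i, Measurable (Z i)) (hZi : iIndepFun Z ℙ)
    (ν : Measure (ℂ × ℝ)) [IsProbabilityMeasure ν] (hZd : ∀ i, Measure.map (Z i) ℙ = ν)
    (a r : ℝ) {k : ℕ} (T : Fin k → Fin k → Prop)
    (D : ENNReal) (hDt : D ≠ ⊤) (hD : ∀ c, ν {v | ‖v.1 - c‖ ≤ r} ≤ D) (n : ℕ) (q : ℝ)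
    (hq : q = (Measure.pi (fun _ : Fin k => ν)).real {w | isoT a r T (fun i => (w i).1) (fun i => (w i).2)}) :
    (n.choose k : ℝ) * q * (1 - k * (n * D.toReal)) ≤
      (∫ ω, (isolatedCount a r T (fun i : Fin n => (Z i ω).1) (fun i : Fin n => (Z i ω).2) : ℝ) ∂ℙ) ∧
    (∫ ω, (isolatedCount a r T (fun i : Fin n => (Z i ω).1) (fun i : Fin n => (Z i ω).2) : ℝ) ∂ℙ) ≤
      (n.choose k : ℝ) * q := by
  classical
  have hI : ∀ k' : ℕ, ∀ g : Fin k → Fin k', MeasurableSet {w : Fin k' → ℂ × ℝ | isoT a r T (fun i => (w (g i)).1) (fun i => (w (g i)).2)} := by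
    intro k' g
    have : Measurable (fun w : Fin k' → ℂ × ℝ => ((fun i => (w (g i)).1, fun i => (w (g i)).2) : (Fin k → ℂ) × (Fin k → ℝ))) := by
      fun_prop
    exact this (isoT_meas a r T)
  set I : Finset (Fin n) → Set Ω := fun s => {ω | ∃ g : Fin k ↪ Fin n, Finset.univ.map g = s ∧
      ∀ i j, T i j ↔ arc a r (fun i : Fin n => (Z i ω).1) (fun i : Fin n => (Z i ω).2) (g i) (g j)} with hIdef
  set J : Finset (Fin n) → Set Ω := fun s => {ω | ∀ i ∈ s, ∀ j, j ∉ s →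
      ¬ arc a r (fun i : Fin n => (Z i ω).1) (fun i : Fin n => (Z i ω).2) i j} with hJdef
  have hIe : ∀ (s : Finset (Fin n)) (hs : s.card = k), I s = (fun ω i => Z ((s.orderEmbOfFin hs i : Fin n) : ℕ) ω) ⁻¹'
      {w | isoT a r T (fun i => (w i).1) (fun i => (w i).2)} := by
    intro s hs
    ext ω
    exact iso_iff a r T _ _ s hs
  have hinj : ∀ (s : Finset (Fin n)) (hs : s.card = k), Function.Injective (fun i => ((s.orderEmbOfFin hs i : Fin n) : ℕ)) :=
    fun s hs => Fin.val_injective.comp (s.orderEmbOfFin hs).injective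
  have hIm : ∀ s : Finset (Fin n), s.card = k → MeasurableSet (I s) := by
    intro s hs
    rw [hIe s hs]
    exact (measurable_pi_lambda _ fun i => hZm _) (hI k id)
  have hIP : ∀ s : Finset (Fin n), s.card = k → ℙ (I s) = Measure.pi (fun _ : Fin k => ν)
      {w | isoT a r T (fun i => (w i).1) (fun i => (w i).2)} := by
    intro s hs
    rw [hIe s hs, ← law_tuple Z hZm hZi ν hZd _ (hinj s hs), Measure.map_apply (measurable_pi_lambda _ fun i => hZm _)]
    exact hI k id
  have harc : ∀ i j : Fin n, MeasurableSet {ω | arc a r (fun i : Fin n => (Z i ω).1) (fun i : Fin n => (Z i ω).2) i j} := by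
    intro i j
    refine (MeasurableSet.const (i ≠ j)).inter ?_
    have hm : Measurable (fun ω => (Z i ω, (Z j ω).1)) := (hZm i).prodMk (measurable_fst.comp (hZm j))
    exact hm (sector_meas a r)
  have hJm : ∀ s : Finset (Fin n), MeasurableSet (J s) := by
    intro s
    simp only [hJdef, Set.ofPred_forall]
    exact MeasurableSet.iInter fun i => MeasurableSet.iInter fun _ => MeasurableSet.iInter fun j =>
      MeasurableSet.iInter fun _ => (harc i j).compl
  have hAm : ∀ s : Finset (Fin n), s.card = k → MeasurableSet (I s ∩ J s) := fun s hs => (hIm s hs).inter (hJm s)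
  have hcount : ∀ ω, (isolatedCount a r T (fun i : Fin n => (Z i ω).1) (fun i : Fin n => (Z i ω).2) : ℝ)
      = ∑ s ∈ Finset.powersetCard k (Finset.univ : Finset (Fin n)), (I s ∩ J s).indicator (1 : Ω → ℝ) ω := by
    intro ω
    have e : {s : Finset (Fin n) |
      (∃ g : Fin k ↪ Fin n, Finset.univ.map g = s ∧
      ∀ i j, T i j ↔ arc a r (fun i : Fin n => (Z i ω).1) (fun i : Fin n => (Z i ω).2) (g i) (g j)) ∧
      ∀ i ∈ s, ∀ j, j ∉ s → ¬ arc a r (fun i : Fin n => (Z i ω).1) (fun i : Fin n => (Z i ω).2) i j}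
      = ((Finset.powersetCard k (Finset.univ : Finset (Fin n))).filter (fun s => ω ∈ I s ∩ J s) : Finset (Finset (Fin n))) := by
      ext s
      simp only [Finset.coe_filter, Finset.mem_powersetCard]
      constructor
      · intro h
        refine ⟨⟨Finset.subset_univ _, ?_⟩, h⟩
        obtain ⟨⟨g, hg, _⟩, _⟩ := h
        rw [← hg]; simp
      · exact fun h => h.2
    rw [isolatedCount, e, Set.ncard_coe_finset, Finset.card_filter]
    push_cast
    refine Finset.sum_congr rfl fun s _ => ?_
    rw [Set.indicator_apply]; rfl
  have hE : (∫ ω, (isolatedCount a r T (fun i : Fin n => (Z i ω).1) (fun i : Fin n => (Z i ω).2) : ℝ) ∂ℙ)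
      = ∑ s ∈ Finset.powersetCard k (Finset.univ : Finset (Fin n)), (ℙ : Measure Ω).real (I s ∩ J s) := by
    simp only [hcount]
    rw [integral_finsetSum]
    · refine Finset.sum_congr rfl fun s hs => ?_
      rw [integral_indicator_one (hAm s (Finset.mem_powersetCard.1 hs).2)]
    · intro s hs
      exact (integrable_const (1:ℝ)).indicator (hAm s (Finset.mem_powersetCard.1 hs).2)
  have hcard : ((Finset.powersetCard k (Finset.univ : Finset (Fin n))).card : ℝ) = n.choose k := by
    rw [Finset.card_powersetCard]; simp
  have hIq : ∀ s : Finset (Fin n), s.card = k → (ℙ : Measure Ω).real (I s) = q := by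
    intro s hs
    rw [hq, measureReal_def, measureReal_def, hIP s hs]
  have hup : ∀ s : Finset (Fin n), s.card = k → (ℙ : Measure Ω).real (I s ∩ J s) ≤ q := by
    intro s hs
    rw [← hIq s hs]
    exact measureReal_mono Set.inter_subset_left
  have hbad : ∀ (s : Finset (Fin n)) (hs : s.card = k), ∀ i : Fin k, ∀ j : Fin n, j ∉ s →
      (ℙ : Measure Ω).real (I s ∩ {ω | ‖(Z j ω).1 - (Z (s.orderEmbOfFin hs i : Fin n) ω).1‖ ≤ r}) ≤ D.toReal * q := by
    intro s hs i j hj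
    have hinj' : Function.Injective (Fin.cons (j : ℕ) (fun i => ((s.orderEmbOfFin hs i : Fin n) : ℕ)) : Fin (k+1) → ℕ) := by
      rw [Fin.cons_injective_iff]
      refine ⟨?_, hinj s hs⟩
      rintro ⟨i, hi⟩
      apply hj
      rw [← Fin.val_injective hi]
      exact Finset.orderEmbOfFin_mem s hs i
    have hlaw := law_tuple Z hZm hZi ν hZd _ hinj'
    have hb := pair_bound a r T ν D hD i
    rw [← hlaw, Measure.map_apply (measurable_pi_lambda _ fun i => hZm _)] at hb
    · rw [hq, measureReal_def, measureReal_def, ← ENNReal.toReal_mul]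
      refine ENNReal.toReal_mono (ENNReal.mul_ne_top hDt (measure_ne_top _ _)) (le_trans (measure_mono ?_) hb)
      rw [hIe s hs]
      exact fun ω hω => hω
    · have hS2 : MeasurableSet {w : Fin (k+1) → ℂ × ℝ | ‖(w 0).1 - (w i.succ).1‖ ≤ r} :=
        measurableSet_le (by fun_prop) (by fun_prop)
      exact (hI (k+1) Fin.succ).inter hS2
  have hlow : ∀ s : Finset (Fin n), s.card = k → q * (1 - k * (n * D.toReal)) ≤ (ℙ : Measure Ω).real (I s ∩ J s) := by
    intro s hs
    have hsub : I s ⊆ (I s ∩ J s) ∪ ⋃ i ∈ (Finset.univ : Finset (Fin k)), ⋃ j ∈ (sᶜ : Finset (Fin n)),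
        (I s ∩ {ω | ‖(Z j ω).1 - (Z (s.orderEmbOfFin hs i : Fin n) ω).1‖ ≤ r}) := by
      intro ω hω
      by_cases hJ : ω ∈ J s
      · exact Or.inl ⟨hω, hJ⟩
      · right
        have hJ' : ¬ ∀ i ∈ s, ∀ j, j ∉ s →
          ¬ arc a r (fun i : Fin n => (Z i ω).1) (fun i : Fin n => (Z i ω).2) i j := hJ
        push Not at hJ'
        obtain ⟨i, hi, j, hj, har⟩ := hJ'
        have hi' : i ∈ Set.range (s.orderEmbOfFin hs) := by rw [Finset.range_orderEmbOfFin]; exact hi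
        obtain ⟨i', rfl⟩ := hi'
        simp only [Set.mem_iUnion]
        refine ⟨i', Finset.mem_univ _, j, Finset.mem_compl.2 hj, hω, har.2.1⟩
    have h1 := (measureReal_mono (μ := (ℙ : Measure Ω)) hsub).trans (measureReal_union_le _ _)
    have h2 : (ℙ : Measure Ω).real (⋃ i ∈ (Finset.univ : Finset (Fin k)), ⋃ j ∈ (sᶜ : Finset (Fin n)),
        (I s ∩ {ω | ‖(Z j ω).1 - (Z (s.orderEmbOfFin hs i : Fin n) ω).1‖ ≤ r})) ≤ k * (n * (D.toReal * q)) := by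
      refine (measureReal_biUnion_finset_le _ _).trans ?_
      refine (Finset.sum_le_card_nsmul _ _ (n * (D.toReal * q)) fun i _ => ?_).trans (by simp)
      refine (measureReal_biUnion_finset_le _ _).trans ?_
      refine (Finset.sum_le_card_nsmul _ _ (D.toReal * q) fun j hj => hbad s hs i j (Finset.mem_compl.1 hj)).trans ?_
      rw [nsmul_eq_mul]
      refine mul_le_mul_of_nonneg_right ?_ (mul_nonneg ENNReal.toReal_nonneg (hq ▸ measureReal_nonneg))
      have := Finset.card_le_univ (sᶜ)
      rw [Fintype.card_fin] at this
      exact_mod_cast this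
    rw [hIq s hs] at h1
    linarith
  rw [hE, ← hcard]
  constructor
  · rw [mul_assoc, ← nsmul_eq_mul]
    exact Finset.card_nsmul_le_sum _ _ _ fun s hs => hlow s (Finset.mem_powersetCard.1 hs).2
  · rw [← nsmul_eq_mul]
    exact Finset.sum_le_card_nsmul _ _ _ fun s hs => hup s (Finset.mem_powersetCard.1 hs).2

lemma choose_lim (k : ℕ) : Tendsto (fun n : ℕ => (n.choose k : ℝ) / (n : ℝ) ^ k) atTop (𝓝 (1 / k.factorial)) := by
  have h := isEquivalent_choose k
  rw [Asymptotics.isEquivalent_iff_tendsto_one] at h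
  · have h2 := h.mul_const (1 / (k.factorial : ℝ))
    rw [one_mul] at h2
    refine h2.congr' ?_
    filter_upwards [eventually_gt_atTop 0] with n hn
    have : (n : ℝ) ≠ 0 := by positivity
    have hf : (k.factorial : ℝ) ≠ 0 := by positivity
    simp only [Pi.div_apply]
    field_simp
  · filter_upwards [eventually_gt_atTop 0] with n hn
    positivity
/-- Proposition 2: asymptotics of the expected number of isolated induced
`T`-subdigraphs when `n rₙ² → 0`. -/
theorem statement5
    {Ω : Type} [MeasureSpace Ω] [IsProbabilityMeasure (ℙ : Measure Ω)]
    -- the common density of the points, bounded and a.e. continuous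
    (f : ℂ → ℝ) (hf0 : ∀ x, 0 ≤ f x) (hfb : ∃ C, ∀ x, f x ≤ C)
    (hfc : ∀ᵐ x : ℂ, ContinuousAt f x)
    -- the central angle α ∈ (0, 2π]
    (a : ℝ) (ha : 0 < a) (ha' : a ≤ 2 * π)
    -- `Z i = (Xᵢ, Yᵢ)`: i.i.d., `Xᵢ` with density `f`, `Yᵢ` uniform on `[0, 2π)`,
    -- the `Xᵢ` independent of the `Yᵢ`
    (Z : ℕ → Ω → ℂ × ℝ) (hZm : ∀ i, Measurable (Z i))
    (hZi : iIndepFun Z ℙ)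
    (hZd : ∀ i, Measure.map (Z i) ℙ =
      (volume.withDensity fun x => ENNReal.ofReal (f x)).prod
        ((ENNReal.ofReal (2 * π))⁻¹ • volume.restrict (Set.Ico 0 (2 * π))))
    -- `T` a feasible connected digraph of order `k`
    (k : ℕ) (hk : 2 ≤ k) (T : Fin k → Fin k → Prop) (hTirr : ∀ i, ¬ T i i)
    (hTconn : (SimpleGraph.fromRel T).Connected)
    (hTfeas : ∃ ρ : ℝ, 0 < ρ ∧
      0 < ℙ {ω | isoT a ρ T (fun i : Fin k => (Z i ω).1) (fun i : Fin k => (Z i ω).2)})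
    -- the positive cutoffs
    (r : ℕ → ℝ) (hrpos : ∀ n, 0 < r n)
    (hr0 : Tendsto (fun n : ℕ => (n : ℝ) * r n ^ 2) atTop (𝓝 0)) :
    Tendsto (fun n : ℕ =>
        (∫ ω, (isolatedCount a (r n) T
          (fun i : Fin n => (Z i ω).1) (fun i : Fin n => (Z i ω).2) : ℝ) ∂ℙ) /
          ((n : ℝ) ^ k * r n ^ (2 * (k - 1))))
      atTop (𝓝 (muT a k T f)) := by
  obtain ⟨m, rfl⟩ : ∃ m, k = m + 1 := ⟨k - 1, by omega⟩
  obtain ⟨C, hC⟩ := hfb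
  have hC0 : 0 ≤ C := (hf0 0).trans (hC 0)
  have hνp : IsProbabilityMeasure ((volume.withDensity fun x => ENNReal.ofReal (f x)).prod
        ((ENNReal.ofReal (2 * π))⁻¹ • (volume : Measure ℝ).restrict (Set.Ico 0 (2 * π)))) := by
    rw [← hZd 0]
    exact Measure.isProbabilityMeasure_map (hZm 0).aemeasurable
  have hρu : ((ENNReal.ofReal (2 * π))⁻¹ • (volume : Measure ℝ).restrict (Set.Ico 0 (2 * π))) Set.univ = 1 := by
    rw [Measure.smul_apply, Measure.restrict_apply_univ, Real.volume_Ico, sub_zero, smul_eq_mul]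
    exact ENNReal.inv_mul_cancel (by simp [Real.pi_pos]) ENNReal.ofReal_ne_top
  have i2 : IsProbabilityMeasure ((ENNReal.ofReal (2 * π))⁻¹ • (volume : Measure ℝ).restrict (Set.Ico 0 (2 * π))) :=
    ⟨hρu⟩
  have hprob : ∫⁻ x, ENNReal.ofReal (f x) = 1 := by
    have h := hνp.measure_univ
    rw [← Set.univ_prod_univ, Measure.prod_prod, hρu, mul_one, withDensity_apply _ MeasurableSet.univ,
      Measure.restrict_univ] at h
    exact h
  have hr : Tendsto r atTop (𝓝 0) := by
    have h1 : Tendsto (fun n => r n ^ 2) atTop (𝓝 0) := by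
      refine squeeze_zero' (Eventually.of_forall fun n => sq_nonneg _) ?_ hr0
      filter_upwards [eventually_ge_atTop 1] with n hn
      have : (1 : ℝ) ≤ n := by exact_mod_cast hn
      nlinarith [sq_nonneg (r n)]
    have h2 := h1.sqrt
    rw [Real.sqrt_zero] at h2
    refine h2.congr fun n => Real.sqrt_sq (hrpos n).le
  have hlim := q_lim f hf0 C hC hfc a hprob T hTconn r hrpos hr
  set ν := ((volume.withDensity fun x => ENNReal.ofReal (f x)).prod
        ((ENNReal.ofReal (2 * π))⁻¹ • (volume : Measure ℝ).restrict (Set.Ico 0 (2 * π)))) with hν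
  set q : ℕ → ℝ := fun n => (Measure.pi (fun _ : Fin (m+1) => ν)).real
        {w | isoT a (r n) T (fun i => (w i).1) (fun i => (w i).2)} with hq
  have hD : ∀ n c, ν {v | ‖v.1 - c‖ ≤ r n} ≤ ENNReal.ofReal (C * (π * r n ^ 2)) := by
    intro n c
    have e : {v : ℂ × ℝ | ‖v.1 - c‖ ≤ r n} = Metric.closedBall c (r n) ×ˢ Set.univ := by
      ext v
      simp [dist_eq_norm]
    rw [e, hν, Measure.prod_prod, hρu, mul_one, withDensity_apply _ Metric.isClosed_closedBall.measurableSet]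
    calc _ ≤ ∫⁻ x in Metric.closedBall c (r n), ENNReal.ofReal C :=
          lintegral_mono fun x => ENNReal.ofReal_le_ofReal (hC x)
      _ = ENNReal.ofReal (C * (π * r n ^ 2)) := by
          rw [setLIntegral_const, Complex.volume_closedBall, ENNReal.ofReal_mul hC0,
            ENNReal.ofReal_mul Real.pi_pos.le, ENNReal.ofReal_pow (hrpos n).le, mul_comm (ENNReal.ofReal π)]
          congr 2
          rw [← NNReal.coe_real_pi, ENNReal.ofReal_coe_nnreal]
  have hb := fun n => count_bound Z hZm hZi ν hZd a (r n) T _ ENNReal.ofReal_ne_top (hD n) n (q n) rfl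
  have hch := choose_lim (m+1)
  have hprod := hch.mul hlim
  have hfac : ((m+1).factorial : ℝ) ≠ 0 := by positivity
  rw [← mul_assoc, one_div, inv_mul_cancel₀ hfac, one_mul] at hprod
  have heps : Tendsto (fun n : ℕ => 1 - ((m+1 : ℕ) : ℝ) * (n * (ENNReal.ofReal (C * (π * r n ^ 2))).toReal)) atTop (𝓝 1) := by
    have h1 : Tendsto (fun n : ℕ => 1 - ((m+1 : ℕ) : ℝ) * (C * π) * (n * r n ^ 2)) atTop (𝓝 (1 - ((m+1 : ℕ) : ℝ) * (C * π) * 0)) :=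
      tendsto_const_nhds.sub (hr0.const_mul _)
    rw [mul_zero, sub_zero] at h1
    refine h1.congr fun n => ?_
    rw [ENNReal.toReal_ofReal (by positivity)]
    ring
  have hprod2 := hprod.mul heps
  rw [mul_one] at hprod2
  refine tendsto_of_tendsto_of_tendsto_of_le_of_le' hprod2 hprod ?_ ?_
  · filter_upwards [eventually_gt_atTop 0] with n hn
    have hn' : (0:ℝ) < n := by exact_mod_cast hn
    have hrn := hrpos n
    have hd : 0 < (n : ℝ) ^ (m+1) * r n ^ (2 * (m + 1 - 1)) := by positivity
    rw [le_div_iff₀ hd]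
    refine le_of_eq_of_le ?_ (hb n).1
    simp only [hq, Nat.add_sub_cancel]
    field_simp
  · filter_upwards [eventually_gt_atTop 0] with n hn
    have hn' : (0:ℝ) < n := by exact_mod_cast hn
    have hrn := hrpos n
    have hd : 0 < (n : ℝ) ^ (m+1) * r n ^ (2 * (m + 1 - 1)) := by positivity
    rw [div_le_iff₀ hd]
    refine (hb n).2.trans_eq ?_
    simp only [hq, Nat.add_sub_cancel]
    field_simp

end
end

section
/- For k ≥ 2, let T be a feasible connected digraph of order k, and let M be a constant such that adding one point (with its inclination) to any finite planar configuration changes the number of isolated T-subdigraphs of the corresponding sector digraph by at most M+1 in absolute value. Then for every ε > 0 and every n, P(|H̃_{n,T} − E[H̃_{n,T}]| > ε·n^k·rₙ^{2(k−1)}) ≤ 2·exp(−ε²·n^{2k−1}·rₙ^{4(k−1)}/(8(M+1)²)). In particular, if ln n = o(n^{2k−1}·rₙ^{4(k−1)}), this bound is summable in n. -/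
open MeasureTheory ProbabilityTheory Filter Real Set
open scoped Topology

noncomputable section

lemma mcd_integrable {E : Type*} [MeasurableSpace E] (μ : Measure E) [IsProbabilityMeasure μ]
    (F : E → ℝ) (hF : Measurable F) (B : ℝ) (hB : ∀ x, |F x| ≤ B) : Integrable F μ :=
  Integrable.of_bound hF.aestronglyMeasurable B (Eventually.of_forall hB)

lemma mcd_exp_integrable {E : Type*} [MeasurableSpace E] (μ : Measure E) [IsProbabilityMeasure μ]
    (F : E → ℝ) (hF : Measurable F) (B : ℝ) (hB : ∀ x, |F x| ≤ B) (s m : ℝ) :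
    Integrable (fun x => Real.exp (s * (F x - m))) μ := by
  refine mcd_integrable μ _ (by fun_prop) (Real.exp (|s| * (B + |m|))) fun x => ?_
  rw [abs_of_pos (Real.exp_pos _)]
  apply Real.exp_le_exp.2
  refine (le_abs_self _).trans ?_
  rw [abs_mul]
  gcongr
  exact (abs_sub _ _).trans (by gcongr; exact hB x)

/-- McDiarmid-type bound on the moment generating function. -/
lemma mcd_mgf {E : Type*} [MeasurableSpace E] (μ : Measure E) [IsProbabilityMeasure μ]
    (c : ℝ) (hc : 0 ≤ c) (s B : ℝ) (n : ℕ) : ∀ (F : (Fin n → E) → ℝ), Measurable F →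
    (∀ x, |F x| ≤ B) →
    (∀ x x' i, (∀ j, j ≠ i → x j = x' j) → |F x - F x'| ≤ c) →
    ∫ x, Real.exp (s * (F x - ∫ x', F x' ∂(Measure.pi fun _ => μ))) ∂(Measure.pi fun _ => μ)
      ≤ Real.exp (n * c ^ 2 * s ^ 2 / 2) := by
  induction n with
  | zero =>
    intro F hF hB hd
    have h : ∀ x : Fin 0 → E, F x = F default := fun x => by rw [Subsingleton.elim x default]
    simp [h]
  | succ n ih =>
    intro F hF hB hd
    set e := MeasurableEquiv.piFinSuccAbove (fun _ : Fin (n + 1) => E) 0 with he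
    have hmp := (measurePreserving_piFinSuccAbove (fun _ : Fin (n + 1) => μ) 0).symm
    set P : Measure (Fin n → E) := Measure.pi fun _ => μ with hP
    set H : E × (Fin n → E) → ℝ := fun p => F (e.symm p) with hH
    have hHm : Measurable H := hF.comp e.symm.measurable
    have hHB : ∀ p, |H p| ≤ B := fun p => hB _
    have hes : ∀ p j, e.symm p j = (Fin.cons p.1 p.2 : Fin (n + 1) → E) j := by
      intro p j
      simp [he, MeasurableEquiv.piFinSuccAbove, Fin.insertNthEquiv]
    set G : (Fin n → E) → ℝ := fun w => ∫ z, H (z, w) ∂μ with hG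
    have hGm : Measurable G :=
      (hHm.stronglyMeasurable.integral_prod_left' (μ := μ)).measurable
    have hint : ∀ w, Integrable (fun z => H (z, w)) μ := fun w =>
      mcd_integrable μ _ (by fun_prop) B fun z => hHB _
    have hGB : ∀ w, |G w| ≤ B := fun w => by
      have := norm_integral_le_of_norm_le_const (μ := μ) (f := fun z => H (z, w)) (C := B)
        (Eventually.of_forall fun z => hHB _)
      simpa using this
    have hGd : ∀ x x' i, (∀ j, j ≠ i → x j = x' j) → |G x - G x'| ≤ c := by
      intro x x' i hx
      simp only [hG]
      rw [← integral_sub (hint x) (hint x')]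
      have := norm_integral_le_of_norm_le_const (μ := μ)
        (f := fun z => H (z, x) - H (z, x')) (C := c)
        (Eventually.of_forall fun z => by
          apply hd _ _ i.succ
          intro j hj
          rw [hes, hes]
          refine Fin.cases ?_ (fun j hj => ?_) j hj
          · intro _; simp
          · simp only [Fin.cons_succ]
            exact hx j fun h => hj (by rw [h]))
      simpa using this
    have hHd : ∀ z z' w, |H (z, w) - H (z', w)| ≤ c := by
      intro z z' w
      apply hd _ _ 0
      intro j hj
      rw [hes, hes]
      refine Fin.cases ?_ (fun j hj => ?_) j hj
      · intro h; exact absurd rfl h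
      · simp
    have hmean : ∫ x', F x' ∂(Measure.pi fun _ => μ) = ∫ w, G w ∂P := by
      rw [← hmp.integral_comp', integral_prod_symm _ (mcd_integrable _ _ hHm B hHB)]
    have hexp : ∀ m : ℝ, ∫ x, Real.exp (s * (F x - m)) ∂(Measure.pi fun _ => μ)
        = ∫ w, ∫ z, Real.exp (s * (H (z, w) - m)) ∂μ ∂P := by
      intro m
      rw [← hmp.integral_comp', integral_prod_symm _ (mcd_exp_integrable _ H hHm B hHB s m)]
    rw [hmean, hexp]
    set m := ∫ w, G w ∂P with hm
    have hin : ∀ w, ∫ z, Real.exp (s * (H (z, w) - m)) ∂μ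
        ≤ Real.exp (c ^ 2 * s ^ 2 / 2) * Real.exp (s * (G w - m)) := by
      intro w
      have hGc : ∀ z, H (z, w) ∈ Set.Icc (G w - c) (G w + c) := by
        intro z
        have h1 : |H (z, w) - G w| ≤ c := by
          have : H (z, w) - G w = ∫ z', (H (z, w) - H (z', w)) ∂μ := by
            rw [integral_sub (integrable_const _) (hint w)]
            simp [hG]
          rw [this]
          have := norm_integral_le_of_norm_le_const (μ := μ)
            (f := fun z' => H (z, w) - H (z', w)) (C := c)
            (Eventually.of_forall fun z' => hHd z z' w)
          simpa using this
        rw [abs_le] at h1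
        constructor <;> linarith
      have hsg := hasSubgaussianMGF_of_mem_Icc (μ := μ) (X := fun z => H (z, w))
        (by fun_prop) (Eventually.of_forall hGc)
      have h2 := hsg.mgf_le s
      have h3 : (((‖(G w + c) - (G w - c)‖₊ / 2) ^ 2 : NNReal) : ℝ) = c ^ 2 := by
        push_cast
        rw [show (G w + c) - (G w - c) = 2 * c by ring, Real.norm_eq_abs, abs_mul, abs_of_nonneg hc]
        norm_num
      rw [h3] at h2
      have h4 : ∀ z, Real.exp (s * (H (z, w) - m))
          = Real.exp (s * (G w - m)) * Real.exp (s * (H (z, w) - G w)) := by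
        intro z; rw [← Real.exp_add]; ring_nf
      simp_rw [h4]
      rw [integral_const_mul, mul_comm]
      gcongr
      exact h2
    calc ∫ w, ∫ z, Real.exp (s * (H (z, w) - m)) ∂μ ∂P
        ≤ ∫ w, Real.exp (c ^ 2 * s ^ 2 / 2) * Real.exp (s * (G w - m)) ∂P := by
          apply integral_mono_of_nonneg
          · exact Eventually.of_forall fun w => integral_nonneg fun z => (Real.exp_pos _).le
          · exact (mcd_exp_integrable P G hGm B hGB s m).const_mul _
          · exact Eventually.of_forall hin
      _ = Real.exp (c ^ 2 * s ^ 2 / 2) * ∫ w, Real.exp (s * (G w - m)) ∂P := by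
          rw [integral_const_mul]
      _ ≤ Real.exp (c ^ 2 * s ^ 2 / 2) * Real.exp (n * c ^ 2 * s ^ 2 / 2) := by
          gcongr
          exact ih G hGm hGB hGd
      _ = _ := by
          rw [← Real.exp_add]; congr 1; push_cast; ring

lemma mcd_subG {E : Type*} [MeasurableSpace E] (μ : Measure E) [IsProbabilityMeasure μ]
    (c : ℝ) (hc : 0 ≤ c) (B : ℝ) (n : ℕ) (F : (Fin n → E) → ℝ) (hF : Measurable F)
    (hB : ∀ x, |F x| ≤ B)
    (hd : ∀ x x' i, (∀ j, j ≠ i → x j = x' j) → |F x - F x'| ≤ c) :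
    HasSubgaussianMGF (fun x => F x - ∫ x', F x' ∂(Measure.pi fun _ => μ))
      (Real.toNNReal (n * c ^ 2)) (Measure.pi fun _ => μ) := by
  refine ⟨fun t => mcd_exp_integrable _ F hF B hB _ _, fun t => ?_⟩
  rw [Real.coe_toNNReal _ (by positivity)]
  exact mcd_mgf μ c hc t B n F hF hB hd

lemma mcd_tail {E : Type*} [MeasurableSpace E] (μ : Measure E) [IsProbabilityMeasure μ]
    (c : ℝ) (hc : 0 ≤ c) (B : ℝ) (n : ℕ) (F : (Fin n → E) → ℝ) (hF : Measurable F)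
    (hB : ∀ x, |F x| ≤ B)
    (hd : ∀ x x' i, (∀ j, j ≠ i → x j = x' j) → |F x - F x'| ≤ c) (t : ℝ) (ht : 0 ≤ t) :
    (Measure.pi fun _ => μ).real {x | t < |F x - ∫ x', F x' ∂(Measure.pi fun _ => μ)|}
      ≤ 2 * Real.exp (-t ^ 2 / (2 * (n * c ^ 2))) := by
  have h := mcd_subG μ c hc B n F hF hB hd
  have h1 := h.measure_ge_le ht
  have h2 := h.neg.measure_ge_le ht
  rw [Real.coe_toNNReal _ (by positivity)] at h1 h2
  have hsub : {x | t < |F x - ∫ x', F x' ∂(Measure.pi fun _ => μ)|} ⊆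
      {x | t ≤ F x - ∫ x', F x' ∂(Measure.pi fun _ => μ)} ∪
      {x | t ≤ (-fun x => F x - ∫ x', F x' ∂(Measure.pi fun _ => μ)) x} := by
    intro x hx
    rcases lt_abs.1 (show t < |F x - ∫ x', F x' ∂(Measure.pi fun _ => μ)| from hx) with h | h
    · exact Or.inl h.le
    · exact Or.inr h.le
  refine (measureReal_mono hsub).trans ((measureReal_union_le _ _).trans ?_)
  linarith


lemma sector_closed (a r : ℝ) :
    IsClosed {q : (ℂ × ℝ) × ℂ | q.2 ∈ sector a q.1.1 q.1.2 r} := by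
  have hK : IsClosed {u : ((ℂ × ℝ) × ℂ) × (Set.Icc (0 : ℝ) a) |
      ‖u.1.2 - u.1.1.1‖ ≤ r ∧ u.1.2 - u.1.1.1 = (‖u.1.2 - u.1.1.1‖ : ℂ) *
        Complex.exp (((u.1.1.2 + (u.2 : ℝ) : ℝ) : ℂ) * Complex.I)} := by
    rw [Set.ofPred_and]
    apply IsClosed.inter
    · exact isClosed_le (by fun_prop) (by fun_prop)
    · exact isClosed_eq (by fun_prop) (by fun_prop)
  have := isClosedMap_fst_of_compactSpace _ hK
  convert this using 1
  ext ⟨⟨x, y⟩, z⟩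
  simp only [sector, Set.mem_ofPred_eq, Set.mem_image]
  constructor
  · rintro ⟨h1, t, h2, h3, h4⟩
    refine ⟨(((x, y), z), ⟨t - y, by constructor <;> linarith⟩), ⟨h1, ?_⟩, rfl⟩
    simpa using h4
  · rintro ⟨⟨⟨⟨x', y'⟩, z'⟩, s⟩, ⟨h1, h2⟩, h3⟩
    simp only [Prod.mk.injEq] at h3
    obtain ⟨⟨rfl, rfl⟩, rfl⟩ := h3
    exact ⟨h1, y' + s, by linarith [s.2.1], by linarith [s.2.2], h2⟩

lemma arc_meas (a r : ℝ) (n : ℕ) (i j : Fin n) :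
    MeasurableSet {w : Fin n → ℂ × ℝ | arc a r (fun i => (w i).1) (fun i => (w i).2) i j} := by
  unfold arc
  by_cases h : i = j
  · simp [h]
  · simp only [ne_eq, h, not_false_eq_true, true_and]
    have : Measurable fun w : Fin n → ℂ × ℝ => ((w i, (w j).1) : (ℂ × ℝ) × ℂ) := by fun_prop
    exact this (sector_closed a r).measurableSet

open Classical in
lemma iso_meas (a r : ℝ) {k : ℕ} (T : Fin k → Fin k → Prop) (n : ℕ) :
    Measurable fun w : Fin n → ℂ × ℝ =>
      (isolatedCount a r T (fun i => (w i).1) (fun i => (w i).2) : ℝ) := by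
  have hset : ∀ s : Finset (Fin n), MeasurableSet {w : Fin n → ℂ × ℝ |
      (∃ g : Fin k ↪ Fin n, Finset.univ.map g = s ∧
        ∀ i j, T i j ↔ arc a r (fun i => (w i).1) (fun i => (w i).2) (g i) (g j)) ∧
      ∀ i ∈ s, ∀ j, j ∉ s → ¬ arc a r (fun i => (w i).1) (fun i => (w i).2) i j} := by
    intro s
    have := arc_meas a r n
    rw [Set.ofPred_and]
    apply MeasurableSet.inter
    · simp only [Set.ofPred_exists]
      refine MeasurableSet.iUnion fun g => ?_
      rw [Set.ofPred_and]
      refine MeasurableSet.inter (MeasurableSet.const _) ?_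
      simp only [Set.ofPred_forall]
      refine MeasurableSet.iInter fun i => MeasurableSet.iInter fun j => ?_
      by_cases hT : T i j
      · simpa [hT] using this (g i) (g j)
      · simp only [hT, false_iff]
        exact (this (g i) (g j)).compl
    · simp only [Set.ofPred_forall]
      refine MeasurableSet.iInter fun i => MeasurableSet.iInter fun _ => MeasurableSet.iInter
        fun j => MeasurableSet.iInter fun _ => ?_
      exact (this i j).compl
  have heq : (fun w : Fin n → ℂ × ℝ =>
      (isolatedCount a r T (fun i => (w i).1) (fun i => (w i).2) : ℝ)) =
      fun w => ∑ s : Finset (Fin n), Set.indicator {w : Fin n → ℂ × ℝ |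
      (∃ g : Fin k ↪ Fin n, Finset.univ.map g = s ∧
        ∀ i j, T i j ↔ arc a r (fun i => (w i).1) (fun i => (w i).2) (g i) (g j)) ∧
      ∀ i ∈ s, ∀ j, j ∉ s → ¬ arc a r (fun i => (w i).1) (fun i => (w i).2) i j}
        (fun _ => (1 : ℝ)) w := by
    funext w
    unfold isolatedCount
    simp only [Set.indicator_apply, Finset.sum_boole, Nat.cast_inj]
    rw [Set.ncard_eq_toFinset_card']
    congr 1
    ext s
    simp
  rw [heq]
  exact Finset.measurable_sum _ fun s _ => measurable_const.indicator (hset s)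

lemma iso_bdd (a r : ℝ) {k : ℕ} (T : Fin k → Fin k → Prop) (n : ℕ) (x : Fin n → ℂ)
    (y : Fin n → ℝ) :
    |(isolatedCount a r T x y : ℝ)| ≤ (Nat.card (Finset (Fin n)) : ℝ) := by
  rw [Nat.abs_cast, Nat.cast_le]
  exact Set.ncard_le_card _

lemma arc_comp (a r : ℝ) {n : ℕ} (σ : Equiv.Perm (Fin n)) (x : Fin n → ℂ) (y : Fin n → ℝ)
    (i j : Fin n) : arc a r (x ∘ σ) (y ∘ σ) i j ↔ arc a r x y (σ i) (σ j) := by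
  simp [arc]

lemma iso_perm_le (a r : ℝ) {k : ℕ} (T : Fin k → Fin k → Prop) {n : ℕ}
    (σ : Equiv.Perm (Fin n)) (x : Fin n → ℂ) (y : Fin n → ℝ) :
    isolatedCount a r T (x ∘ σ) (y ∘ σ) ≤ isolatedCount a r T x y := by
  unfold isolatedCount
  refine Set.ncard_le_ncard_of_injOn (fun s => s.map σ.toEmbedding) ?_ ?_ (Set.toFinite _)
  · rintro s ⟨⟨g, hg, hT⟩, hi⟩
    refine ⟨⟨g.trans σ.toEmbedding, ?_, ?_⟩, ?_⟩
    · rw [← hg, Finset.map_map]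
    · intro i j
      rw [hT i j, arc_comp]
      rfl
    · intro i his j hjs
      have h1 := hi (σ.symm i) (by simpa using his) (σ.symm j) (by simpa using hjs)
      rw [arc_comp] at h1
      simpa using h1
  · intro s _ t _ h
    exact Finset.map_injective _ h

lemma iso_perm (a r : ℝ) {k : ℕ} (T : Fin k → Fin k → Prop) {n : ℕ}
    (σ : Equiv.Perm (Fin n)) (x : Fin n → ℂ) (y : Fin n → ℝ) :
    isolatedCount a r T (x ∘ σ) (y ∘ σ) = isolatedCount a r T x y := by
  apply le_antisymm (iso_perm_le a r T σ x y)
  have := iso_perm_le a r T σ.symm (x ∘ σ) (y ∘ σ)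
  simpa [Function.comp_assoc] using this

lemma iso_diff (a r : ℝ) {k : ℕ} (T : Fin k → Fin k → Prop) (M : ℝ)
    (hM : ∀ (n : ℕ) (x : Fin n → ℂ) (y : Fin n → ℝ) (p : ℂ) (q : ℝ),
      |(isolatedCount a r T (Fin.snoc x p) (Fin.snoc y q) : ℝ) -
        (isolatedCount a r T x y : ℝ)| ≤ M + 1) {n : ℕ} (w w' : Fin n → ℂ × ℝ) (i : Fin n)
    (hw : ∀ j, j ≠ i → w j = w' j) :
    |(isolatedCount a r T (fun i => (w i).1) (fun i => (w i).2) : ℝ) -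
      (isolatedCount a r T (fun i => (w' i).1) (fun i => (w' i).2) : ℝ)| ≤ 2 * (M + 1) := by
  cases n with
  | zero => exact i.elim0
  | succ n =>
    set σ : Equiv.Perm (Fin (n + 1)) := Equiv.swap i (Fin.last n) with hσ
    have key : ∀ w : Fin (n + 1) → ℂ × ℝ,
        |(isolatedCount a r T (fun i => (w i).1) (fun i => (w i).2) : ℝ) -
          isolatedCount a r T (fun j : Fin n => (w (σ j.castSucc)).1)
            (fun j : Fin n => (w (σ j.castSucc)).2)| ≤ M + 1 := by
      intro w
      have h := hM n (fun j : Fin n => (w (σ j.castSucc)).1)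
            (fun j : Fin n => (w (σ j.castSucc)).2) (w i).1 (w i).2
      have e1 : (Fin.snoc (fun j : Fin n => (w (σ j.castSucc)).1) (w i).1 : Fin (n + 1) → ℂ)
          = (fun i => (w i).1) ∘ σ := by
        funext j
        refine Fin.lastCases ?_ (fun j => ?_) j <;> simp [hσ]
      have e2 : (Fin.snoc (fun j : Fin n => (w (σ j.castSucc)).2) (w i).2 : Fin (n + 1) → ℝ)
          = (fun i => (w i).2) ∘ σ := by
        funext j
        refine Fin.lastCases ?_ (fun j => ?_) j <;> simp [hσ]
      rw [e1, e2, iso_perm] at h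
      exact h
    have h1 := key w
    have h2 := key w'
    have h3 : ∀ j : Fin n, w (σ j.castSucc) = w' (σ j.castSucc) := by
      intro j
      apply hw
      intro h
      have : σ j.castSucc = σ (Fin.last n) := by rw [h]; simp [hσ]
      exact (Fin.castSucc_lt_last j).ne (σ.injective this)
    simp only [h3] at h1
    rw [abs_le] at *
    constructor <;> linarith [h1.1, h1.2, h2.1, h2.2]

lemma iso_pos (a r : ℝ) {k : ℕ} (T : Fin k → Fin k → Prop) (x : Fin k → ℂ) (y : Fin k → ℝ)
    (h : isoT a r T x y) : 0 < isolatedCount a r T x y := by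
  obtain ⟨e, he⟩ := h
  unfold isolatedCount
  rw [Set.ncard_pos (Set.toFinite _)]
  refine ⟨Finset.univ, ⟨e.toEmbedding, by simp, he⟩, ?_⟩
  intro i _ j hj
  exact absurd (Finset.mem_univ j) hj

lemma M_pos (a r : ℝ) {k : ℕ} (hk : 2 ≤ k) (T : Fin k → Fin k → Prop) (M : ℝ)
    (hM : ∀ (n : ℕ) (x : Fin n → ℂ) (y : Fin n → ℝ) (p : ℂ) (q : ℝ),
      |(isolatedCount a r T (Fin.snoc x p) (Fin.snoc y q) : ℝ) -
        (isolatedCount a r T x y : ℝ)| ≤ M + 1)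
    (x : Fin k → ℂ) (y : Fin k → ℝ) (h : isoT a r T x y) : 0 < M + 1 := by
  by_contra hneg
  push Not at hneg
  have hz : ∀ (n : ℕ) (x : Fin n → ℂ) (y : Fin n → ℝ), isolatedCount a r T x y = 0 := by
    intro n
    induction n with
    | zero =>
      intro x y
      unfold isolatedCount
      rw [Set.ncard_eq_zero (Set.toFinite _), Set.eq_empty_iff_forall_notMem]
      rintro s ⟨⟨g, -⟩, -⟩
      exact (g ⟨0, by omega⟩).elim0
    | succ n ih =>
      intro x y
      have h1 := hM n (Fin.init x) (Fin.init y) (x (Fin.last n)) (y (Fin.last n))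
      rw [Fin.snoc_init_self, Fin.snoc_init_self, ih] at h1
      have h2 := abs_nonpos_iff.1 (h1.trans hneg)
      simpa using h2
  exact (iso_pos a r T x y h).ne' (hz k x y)

/-- The Azuma-type concentration bound for `H̃_{n,T}` at scale `n^k rₙ^{2(k-1)}`:
`P(|H̃_{n,T} - E[H̃_{n,T}]| > ε n^k rₙ^{2(k-1)}) ≤
  2 exp(-ε² n^{2k-1} rₙ^{4(k-1)} / (8 (M+1)²))`; moreover if
`ln n = o(n^{2k-1} rₙ^{4(k-1)})` this bound is summable in `n`. -/
theorem statement12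
    {Ω : Type} [MeasureSpace Ω] [IsProbabilityMeasure (ℙ : Measure Ω)]
    -- the common density of the points, bounded and a.e. continuous
    (f : ℂ → ℝ) (hf0 : ∀ x, 0 ≤ f x) (hfb : ∃ C, ∀ x, f x ≤ C)
    (hfc : ∀ᵐ x : ℂ, ContinuousAt f x)
    -- the central angle α ∈ (0, 2π]
    (a : ℝ) (ha : 0 < a) (ha' : a ≤ 2 * π)
    -- `Z i = (Xᵢ, Yᵢ)`: i.i.d., `Xᵢ` with density `f`, `Yᵢ` uniform on `[0, 2π)`,
    -- the `Xᵢ` independent of the `Yᵢ`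
    (Z : ℕ → Ω → ℂ × ℝ) (hZm : ∀ i, Measurable (Z i))
    (hZi : iIndepFun Z ℙ)
    (hZd : ∀ i, Measure.map (Z i) ℙ =
      (volume.withDensity fun x => ENNReal.ofReal (f x)).prod
        ((ENNReal.ofReal (2 * π))⁻¹ • volume.restrict (Set.Ico 0 (2 * π))))
    -- `T` a feasible connected digraph of order `k`
    (k : ℕ) (hk : 2 ≤ k) (T : Fin k → Fin k → Prop) (hTirr : ∀ i, ¬ T i i)
    (hTconn : (SimpleGraph.fromRel T).Connected)
    (hTfeas : ∃ ρ : ℝ, 0 < ρ ∧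
      0 < ℙ {ω | isoT a ρ T (fun i : Fin k => (Z i ω).1) (fun i : Fin k => (Z i ω).2)})
    -- the positive cutoffs
    (r : ℕ → ℝ) (hrpos : ∀ n, 0 < r n)
    -- `M` bounds the change of the isolated `T`-subdigraph count caused by adding
    -- one point (with its inclination) to any finite planar configuration
    (M : ℝ)
    (hM : ∀ (ρ : ℝ) (n : ℕ) (x : Fin n → ℂ) (y : Fin n → ℝ) (p : ℂ) (q : ℝ),
      |(isolatedCount a ρ T (Fin.snoc x p) (Fin.snoc y q) : ℝ) -
        (isolatedCount a ρ T x y : ℝ)| ≤ M + 1)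
    : (∀ ε : ℝ, 0 < ε → ∀ n : ℕ,
      (ℙ {ω | ε * ((n : ℝ) ^ k * r n ^ (2 * (k - 1))) <
        |(isolatedCount a (r n) T
            (fun i : Fin n => (Z i ω).1) (fun i : Fin n => (Z i ω).2) : ℝ) -
          ∫ ω', (isolatedCount a (r n) T
            (fun i : Fin n => (Z i ω').1) (fun i : Fin n => (Z i ω').2) : ℝ) ∂ℙ|}).toReal ≤
      2 * Real.exp (-(ε ^ 2 * (n : ℝ) ^ (2 * k - 1) * r n ^ (4 * (k - 1))) /
        (8 * (M + 1) ^ 2))) ∧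
    ((fun n : ℕ => Real.log n) =o[atTop]
        (fun n : ℕ => (n : ℝ) ^ (2 * k - 1) * r n ^ (4 * (k - 1))) →
      ∀ ε : ℝ, 0 < ε →
        Summable (fun n : ℕ =>
          2 * Real.exp (-(ε ^ 2 * (n : ℝ) ^ (2 * k - 1) * r n ^ (4 * (k - 1))) /
            (8 * (M + 1) ^ 2)))) := by
  have hM' := fun ρ => hM ρ
  have hMpos : 0 < M + 1 := by
    obtain ⟨ρ, -, hρ⟩ := hTfeas
    obtain ⟨ω, hω⟩ := nonempty_of_measure_ne_zero hρ.ne'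
    exact M_pos a ρ hk T M (hM ρ) _ _ hω
  constructor
  · intro ε hε n
    rcases Nat.eq_zero_or_pos n with hn0 | hn0
    · have : (0 : ℕ) ^ (2 * k - 1) = 0 := zero_pow (by omega)
      have h1 : ((n : ℝ)) ^ (2 * k - 1) = 0 := by
        rw [hn0]; exact_mod_cast this
      rw [h1]
      simp only [mul_zero, zero_mul, neg_zero, zero_div, Real.exp_zero, mul_one]
      exact (measureReal_le_one (μ := (ℙ : Measure Ω))).trans (by norm_num)
    set μ : Measure (ℂ × ℝ) := Measure.map (Z 0) ℙ with hμ
    haveI : IsProbabilityMeasure μ := Measure.isProbabilityMeasure_map (hZm 0).aemeasurable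
    set W : Ω → Fin n → ℂ × ℝ := fun ω i => Z i ω with hW
    have hWm : Measurable W := measurable_pi_iff.2 fun i => hZm i
    have hlaw : Measure.map W ℙ = Measure.pi fun _ : Fin n => μ := by
      have h1 : iIndepFun (fun i : Fin n => Z i) ℙ := hZi.precomp Fin.val_injective
      have h2 := (iIndepFun_iff_map_fun_eq_pi_map (fun i : Fin n => (hZm i).aemeasurable)).1 h1
      rw [hW, h2]
      congr 1
      funext i
      rw [hμ, hZd, hZd]
    set F : (Fin n → ℂ × ℝ) → ℝ := fun w =>
      (isolatedCount a (r n) T (fun i => (w i).1) (fun i => (w i).2) : ℝ) with hF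
    have hFm : Measurable F := iso_meas a (r n) T n
    have ht : 0 ≤ ε * ((n : ℝ) ^ k * r n ^ (2 * (k - 1))) := by
      have := hrpos n
      positivity
    have key := mcd_tail μ (2 * (M + 1)) (by linarith) (Nat.card (Finset (Fin n))) n F hFm
      (fun w => iso_bdd a (r n) T n _ _) (fun w w' i hw => iso_diff a (r n) T M (hM (r n)) w w' i hw)
      _ ht
    rw [← hlaw, integral_map hWm.aemeasurable hFm.aestronglyMeasurable, map_measureReal_apply hWm
      (measurableSet_lt measurable_const (by fun_prop))] at key
    refine le_trans (le_of_eq ?_) (key.trans (le_of_eq ?_))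
    · rfl
    · congr 2
      have hn : (n : ℝ) ≠ 0 := by positivity
      obtain ⟨l, rfl⟩ : ∃ l, k = l + 1 := ⟨k - 1, by omega⟩
      rw [show 2 * (l + 1) - 1 = 2 * l + 1 by omega, show l + 1 - 1 = l by omega]
      field_simp
      ring
  · intro hlo ε hε
    set C : ℝ := ε ^ 2 / (8 * (M + 1) ^ 2) with hC
    have hCpos : 0 < C := by positivity
    have hev := hlo.def (show 0 < C / 2 by positivity)
    have hs : Summable fun n : ℕ => 2 * (1 / (n : ℝ) ^ 2) :=
      (Real.summable_one_div_nat_pow.2 (by norm_num)).mul_left 2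
    refine Summable.of_norm_bounded_eventually_nat hs ?_
    filter_upwards [hev, eventually_ge_atTop 1] with n hn hn1
    have hn0 : (0 : ℝ) < n := by exact_mod_cast hn1
    have hb : 0 ≤ (n : ℝ) ^ (2 * k - 1) * r n ^ (4 * (k - 1)) := by
      have := hrpos n
      positivity
    rw [Real.norm_eq_abs, Real.norm_eq_abs, abs_of_nonneg hb] at hn
    have hl := (le_abs_self _).trans hn
    rw [Real.norm_eq_abs, abs_of_pos (by positivity)]
    have h2 : 1 / (n : ℝ) ^ 2 = Real.exp (-(2 * Real.log n)) := by
      rw [Real.exp_neg, mul_comm, Real.exp_mul, Real.exp_log hn0]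
      norm_num
    rw [h2]
    gcongr
    have h3 : -(ε ^ 2 * (n : ℝ) ^ (2 * k - 1) * r n ^ (4 * (k - 1))) / (8 * (M + 1) ^ 2)
        = -(C * ((n : ℝ) ^ (2 * k - 1) * r n ^ (4 * (k - 1)))) := by
      rw [hC]; ring
    rw [h3]
    linarith

end
end
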